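/- Let d ∈ ℕ with 1 ≤ d, let ε ≥ 0, s₁ ≥ 0, s₂ ≥ 0. For i = 1, 2 let t_{i1} ≤ t_{i2} be real numbers, let p_{i1}, p_{i2} ∈ EuclideanSpace ℝ (Fin d), let SEG_i : ℝ → EuclideanSpace ℝ (Fin d) satisfy SEG_i t ∈ segment ℝ p_{i1} p_{i2} for every t ∈ Icc t_{i1} t_{i2}, and let q_i : ℝ → EuclideanSpace ℝ (Fin d) satisfy ‖q_i t - SEG_i t‖ ≤ ε for every t ∈ Icc t_{i1} t_{i2}. Suppose that either Icc t₁₁ t₁₂ ∩ Icc t₂₁ t₂₂ = ∅, or ‖(p₁₁ + p₁₂)/2 - (p₂₁ + p₂₂)/2‖₁ ≥ ‖(p₁₁ - p₁₂)/2‖₁ + ‖(p₂₁ - p₂₂)/2‖₁ + (2ε + s₁ + s₂)·√d. Then for every t ∈ Icc t₁₁ t₁₂ ∩ Icc t₂₁ t₂₂, one has ‖q₁ t - q₂ t‖ ≥ s₁ + s₂. -/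

import Mathlib

theorem EuclideanSpace.sum_abs_le_sqrt_card_mul_norm {ι : Type*} [Fintype ι]
    (x : EuclideanSpace ℝ ι) : ∑ i, |x i| ≤ Real.sqrt (Fintype.card ι) * ‖x‖ := by
  rw [EuclideanSpace.norm_eq, ← Real.sqrt_mul (Nat.cast_nonneg _)]
  refine Real.le_sqrt_of_sq_le ?_
  simpa using sq_sum_le_card_mul_sum_sq (s := Finset.univ) (f := fun i => |x i|)

theorem EuclideanSpace.abs_midpoint_sub_apply_le {ι : Type*} [Fintype ι]
    {p q x : EuclideanSpace ℝ ι} (hx : x ∈ segment ℝ p q) (i : ι) :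
    |((2⁻¹ : ℝ) • (p + q)) i - x i| ≤ |((2⁻¹ : ℝ) • (p - q)) i| := by
  obtain ⟨a, b, ha, hb, hab, rfl⟩ := hx
  obtain rfl : b = 1 - a := by linarith
  simp only [PiLp.smul_apply, PiLp.add_apply, PiLp.sub_apply, smul_eq_mul]
  rw [show 2⁻¹ * (p i + q i) - (a * p i + (1 - a) * q i) =
    (1 - 2 * a) * (2⁻¹ * (p i - q i)) by ring, abs_mul]
  refine mul_le_of_le_one_left (abs_nonneg _) (abs_le.mpr ⟨?_, ?_⟩) <;> linarith

theorem stmt_7 {d : ℕ} (hd : 1 ≤ d)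
    (ε s₁ s₂ : ℝ) (hε : ε ≥ 0) (hs₁ : s₁ ≥ 0) (hs₂ : s₂ ≥ 0)
    (t₁₁ t₁₂ t₂₁ t₂₂ : ℝ) (ht₁ : t₁₁ ≤ t₁₂) (ht₂ : t₂₁ ≤ t₂₂)
    (p₁₁ p₁₂ p₂₁ p₂₂ : EuclideanSpace ℝ (Fin d))
    (SEG₁ SEG₂ q₁ q₂ : ℝ → EuclideanSpace ℝ (Fin d))
    (hSEG₁ : ∀ t ∈ Set.Icc t₁₁ t₁₂, SEG₁ t ∈ segment ℝ p₁₁ p₁₂)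
    (hSEG₂ : ∀ t ∈ Set.Icc t₂₁ t₂₂, SEG₂ t ∈ segment ℝ p₂₁ p₂₂)
    (hq₁ : ∀ t ∈ Set.Icc t₁₁ t₁₂, ‖q₁ t - SEG₁ t‖ ≤ ε)
    (hq₂ : ∀ t ∈ Set.Icc t₂₁ t₂₂, ‖q₂ t - SEG₂ t‖ ≤ ε)
    (hsafe : Set.Icc t₁₁ t₁₂ ∩ Set.Icc t₂₁ t₂₂ = ∅ ∨
      (∑ i, |((2⁻¹ : ℝ) • (p₁₁ + p₁₂) - (2⁻¹ : ℝ) • (p₂₁ + p₂₂)) i|) ≥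
        (∑ i, |((2⁻¹ : ℝ) • (p₁₁ - p₁₂)) i|)
        + (∑ i, |((2⁻¹ : ℝ) • (p₂₁ - p₂₂)) i|)
        + (2 * ε + s₁ + s₂) * Real.sqrt d) :
    ∀ t ∈ Set.Icc t₁₁ t₁₂ ∩ Set.Icc t₂₁ t₂₂,
      ‖q₁ t - q₂ t‖ ≥ s₁ + s₂ := by
  rintro t ⟨h₁, h₂⟩
  rcases hsafe with hempty | hsafe
  · exact (hempty.subset ⟨h₁, h₂⟩).elim
  have hsqrt : 0 < Real.sqrt d := Real.sqrt_pos.mpr (by exact_mod_cast hd)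
  have hsum : (∑ i, |((2⁻¹ : ℝ) • (p₁₁ + p₁₂) - (2⁻¹ : ℝ) • (p₂₁ + p₂₂)) i|) ≤
      (∑ i, |((2⁻¹ : ℝ) • (p₁₁ - p₁₂)) i|) + (∑ i, |((2⁻¹ : ℝ) • (p₂₁ - p₂₂)) i|)
      + ∑ i, |(SEG₁ t - SEG₂ t) i| := by
    rw [← Finset.sum_add_distrib, ← Finset.sum_add_distrib]
    refine Finset.sum_le_sum fun i _ => ?_
    have e₁ := EuclideanSpace.abs_midpoint_sub_apply_le (hSEG₁ t h₁) i
    have e₂ := EuclideanSpace.abs_midpoint_sub_apply_le (hSEG₂ t h₂) i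
    refine le_trans ?_ (add_le_add_left (add_le_add e₁ e₂) _)
    rw [PiLp.sub_apply, PiLp.sub_apply, abs_sub_comm _ (SEG₂ t i), add_right_comm]
    refine le_trans (le_of_eq ?_) (abs_add_three _ _ _)
    congr 1
    ring
  have hnorm := EuclideanSpace.sum_abs_le_sqrt_card_mul_norm (SEG₁ t - SEG₂ t)
  rw [Fintype.card_fin] at hnorm
  have hsep : 2 * ε + s₁ + s₂ ≤ ‖SEG₁ t - SEG₂ t‖ := by
    refine le_of_mul_le_mul_right ?_ hsqrt
    linarith
  have htri : ‖SEG₁ t - SEG₂ t‖ ≤ ‖q₁ t - SEG₁ t‖ + ‖q₁ t - q₂ t‖ + ‖q₂ t - SEG₂ t‖ := by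
    rw [norm_sub_rev (q₁ t) (SEG₁ t)]
    refine le_trans (le_of_eq ?_) norm_add₃_le
    congr 1
    abel
  linarith [hq₁ t h₁, hq₂ t h₂]
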